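/- For every finite nonempty decision alphabet 𝒟, finite nonempty input alphabet 𝒳, and sequence length n ≥ 1, the set P_L of conditional distributions realizable by locally normalized models with prefix-restricted scoring functions is contained in the set P_G of conditional distributions realizable by globally normalized models with prefix-restricted scoring functions: for every prefix-restricted scoring function ρ there exists a prefix-restricted scoring function ρ' such that p_{G,ρ'}(d_{1:n} | x_{1:n}) = p_{L,ρ}(d_{1:n} | x_{1:n}) for all x_{1:n} ∈ 𝒳^n and d_{1:n} ∈ 𝒟^n. -/

import Mathlib

/-!
Setting: a finite nonempty decision alphabet `D`, a finite nonempty input alphabet `X`,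
and a sequence length `n ≥ 1`.  A scoring function assigns a real score `ρ i d x` to a
position `i`, a decision sequence `d` and an input sequence `x`; the intended reading is
that `ρ i d x` scores the decision `d i` in the context of the decision prefix
`d 0, …, d (i-1)` and the input prefix `x 0, …, x i`.  This prefix restriction is encoded
by the predicate `IsPrefixRestricted`.
-/

/-- `ρ i d x` may depend only on the decision prefix `d 0, …, d (i-1)`, the decision `d i`,
and the input prefix `x 0, …, x i`. -/
def IsPrefixRestricted {D X : Type} {n : ℕ}
    (ρ : Fin n → (Fin n → D) → (Fin n → X) → ℝ) : Prop :=
  ∀ (i : Fin n) (d d' : Fin n → D) (x x' : Fin n → X),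
    (∀ j : Fin n, j < i → d j = d' j) → d i = d' i →
    (∀ j : Fin n, j ≤ i → x j = x' j) → ρ i d x = ρ i d' x'

/-- The locally normalized model:
`p_L(d_{1:n} | x_{1:n}) = ∏ᵢ exp (ρ(d_{1:i-1}, dᵢ, x_{1:i})) / Z_L(d_{1:i-1}, x_{1:i})`,
where `Z_L(d_{1:i-1}, x_{1:i}) = ∑_{d'} exp (ρ(d_{1:i-1}, d', x_{1:i}))`. -/
noncomputable def pL {D X : Type} {n : ℕ} [Fintype D] [DecidableEq D]
    (ρ : Fin n → (Fin n → D) → (Fin n → X) → ℝ) (d : Fin n → D) (x : Fin n → X) : ℝ :=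
  ∏ i : Fin n,
    Real.exp (ρ i d x) / ∑ e : D, Real.exp (ρ i (Function.update d i e) x)

/-- The globally normalized model:
`p_G(d_{1:n} | x_{1:n}) = exp (∑ᵢ ρ(d_{1:i-1}, dᵢ, x_{1:i})) / Z_G(x_{1:n})`,
where `Z_G(x_{1:n}) = ∑_{d'_{1:n}} exp (∑ᵢ ρ(d'_{1:i-1}, d'ᵢ, x_{1:i}))`. -/
noncomputable def pG {D X : Type} {n : ℕ} [Fintype D]
    (ρ : Fin n → (Fin n → D) → (Fin n → X) → ℝ) (d : Fin n → D) (x : Fin n → X) : ℝ :=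
  Real.exp (∑ i : Fin n, ρ i d x) /
    ∑ d' : Fin n → D, Real.exp (∑ i : Fin n, ρ i d' x)

/-- A product of causal factors, each summing to one over its last decision, sums to one over
all decision sequences. -/
theorem sum_prod_eq_one_of_causal {D : Type*} [Fintype D] [DecidableEq D] [Nonempty D] {n : ℕ}
    (f : Fin n → (Fin n → D) → ℝ)
    (hf : ∀ i d d', (∀ j, j ≤ i → d j = d' j) → f i d = f i d')
    (hsum : ∀ i d, ∑ e : D, f i (Function.update d i e) = 1) :
    ∑ d : Fin n → D, ∏ i, f i d = 1 := by
  induction n with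
  | zero => simp
  | succ n ih =>
    obtain ⟨a₀⟩ := ‹Nonempty D›
    have : Nonempty D := ⟨a₀⟩
    rw [← (Fin.consEquiv (fun _ : Fin (n + 1) => D)).sum_comp, Fintype.sum_prod_type]
    have hinner : ∀ a : D,
        ∑ d : Fin n → D, ∏ i, f i (Fin.cons a d) = f 0 (Fin.cons a fun _ => a₀) := by
      intro a
      have hhead : ∀ d : Fin n → D,
          f 0 (Fin.cons a d) = f 0 (Fin.cons a fun _ => a₀) := by
        intro d
        refine hf _ _ _ fun j hj => ?_
        obtain rfl : j = 0 := by simpa using hj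
        rfl
      have htail := ih (fun i d => f i.succ (Fin.cons a d))
        (fun i d d' h => hf _ _ _ fun j hj => by
          cases j using Fin.cases with
          | zero => rfl
          | succ j => simpa using h j (Fin.succ_le_succ_iff.mp hj))
        (fun i d => by simpa only [Fin.cons_update] using hsum i.succ (Fin.cons a d))
      simp only [Fin.prod_univ_succ, hhead]
      rw [← Finset.mul_sum, htail, mul_one]
    calc
      _ = ∑ a : D, f 0 (Fin.cons a fun _ => a₀) := Finset.sum_congr rfl fun a _ => hinner a
      _ = 1 := by
        simpa only [Fin.update_cons_zero] using hsum 0 (Fin.cons a₀ fun _ => a₀)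

/-- `P_L ⊆ P_G`: for every prefix-restricted scoring function `ρ` there is a
prefix-restricted scoring function `ρ'` whose globally normalized model coincides with the
locally normalized model of `ρ` on all inputs and decision sequences. -/
theorem local_subset_global
    (D X : Type) [Fintype D] [DecidableEq D] [Nonempty D] [Fintype X] [Nonempty X]
    (n : ℕ) (hn : 1 ≤ n)
    (ρ : Fin n → (Fin n → D) → (Fin n → X) → ℝ) (hρ : IsPrefixRestricted ρ) :
    ∃ ρ' : Fin n → (Fin n → D) → (Fin n → X) → ℝ,
      IsPrefixRestricted ρ' ∧
        ∀ (x : Fin n → X) (d : Fin n → D), pG ρ' d x = pL ρ d x := by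
  have hZpos : ∀ i d x, 0 < ∑ e : D, Real.exp (ρ i (Function.update d i e) x) := fun i d x =>
    Finset.sum_pos (fun e _ => Real.exp_pos _) Finset.univ_nonempty
  have hZ : ∀ i d d' x x', (∀ j, j < i → d j = d' j) → (∀ j, j ≤ i → x j = x' j) →
      ∑ e : D, Real.exp (ρ i (Function.update d i e) x) =
        ∑ e : D, Real.exp (ρ i (Function.update d' i e) x') := by
    intro i d d' x x' hd hx
    refine Finset.sum_congr rfl fun e _ => congrArg Real.exp (hρ i _ _ _ _ ?_ (by simp) hx)
    intro j hj
    simpa [hj.ne] using hd j hj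
  have hexp : ∀ d x, Real.exp (∑ i, (ρ i d x -
      Real.log (∑ e : D, Real.exp (ρ i (Function.update d i e) x)))) = pL ρ d x := by
    intro d x
    simp only [pL, Real.exp_sum, Real.exp_sub, Real.exp_log (hZpos _ _ _)]
  refine ⟨fun i d x => ρ i d x -
    Real.log (∑ e : D, Real.exp (ρ i (Function.update d i e) x)), ?_, ?_⟩
  · intro i d d' x x' hd hdi hx
    simp only [hρ i d d' x x' hd hdi hx, hZ i d d' x x' hd hx]
  · intro x d
    have hone : ∑ d' : Fin n → D, pL ρ d' x = 1 := by
      refine sum_prod_eq_one_of_causal _ (fun i d d' h => ?_) (fun i d => ?_)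
      · rw [hρ i d d' x x (fun j hj => h j hj.le) (h i le_rfl) fun _ _ => rfl,
          hZ i d d' x x (fun j hj => h j hj.le) fun _ _ => rfl]
      · simp only [Function.update_idem]
        rw [← Finset.sum_div, div_self (hZpos i d x).ne']
    simp only [pG, hexp, hone, div_one]
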